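/- Combinatorial form of Proposition 4.2: There is a constant C such that every full binary tree T with n ≥ 2 nodes admits a hierarchical definition P of depth at most C·log₂ n and width at most 5. -/

import Mathlib

/-- A finite rooted ordered tree, given by its finite, prefix-closed set of node
positions; a position is the list of child directions from the root.  In a
`k`-ordered tree every node has, for each `i : Fin k`, at most one `i`-th child,
which is automatic in this representation. -/
structure PosTree (k : ℕ) where
  nodes : Finset (List (Fin k))
  root_mem : [] ∈ nodes
  prefix_closed : ∀ u v : List (Fin k), u <+: v → v ∈ nodes → u ∈ nodes

/-- A full binary tree: every node has either no children or both children. -/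
def PosTree.IsFullBinary (T : PosTree 2) : Prop :=
  ∀ v ∈ T.nodes, ∀ i j : Fin 2, v ++ [i] ∈ T.nodes → v ++ [j] ∈ T.nodes

/-- A pattern in a tree: either a subtree pattern (a single node) or a context
pattern (a pair of a node and a proper descendant). -/
inductive Pattern (k : ℕ) : Type
  | subtree : List (Fin k) → Pattern k
  | context : List (Fin k) → List (Fin k) → Pattern k
deriving DecidableEq

/-- Validity of a pattern in a tree `T`: the nodes belong to `T`, and for a
context pattern `(v,w)` the node `w` is a proper descendant of `v`. -/
def Pattern.Valid {k : ℕ} (T : PosTree k) : Pattern k → Prop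
  | .subtree v => v ∈ T.nodes
  | .context v w => v ∈ T.nodes ∧ w ∈ T.nodes ∧ v <+: w ∧ v ≠ w

/-- The set `V[p]` of nodes covered by a pattern. -/
def Pattern.cover {k : ℕ} (T : PosTree k) : Pattern k → Set (List (Fin k))
  | .subtree v => {u | u ∈ T.nodes ∧ v <+: u}
  | .context v w => {u | u ∈ T.nodes ∧ v <+: u ∧ ¬ w <+: u}

/-- The root of a pattern. -/
def Pattern.root {k : ℕ} : Pattern k → List (Fin k)
  | .subtree v => v
  | .context v _ => v

/-- A hierarchical definition of `T`: a well-nested set of valid patterns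
containing the largest pattern (the root of `T`). -/
structure IsHierDef {k : ℕ} (T : PosTree k) (P : Finset (Pattern k)) : Prop where
  valid : ∀ p ∈ P, p.Valid T
  root_mem : Pattern.subtree ([] : List (Fin k)) ∈ P
  nested : ∀ p ∈ P, ∀ q ∈ P,
    Disjoint (p.cover T) (q.cover T) ∨ p.cover T ⊆ q.cover T ∨ q.cover T ⊆ p.cover T

/-- `q` is a direct subpattern of `p` (with respect to `P`): `q < p` and no
`r ∈ P` lies strictly between them. -/
def DirectSub {k : ℕ} (T : PosTree k) (P : Finset (Pattern k))
    (q p : Pattern k) : Prop :=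
  q ∈ P ∧ p ∈ P ∧ q.cover T ⊂ p.cover T ∧
    ∀ r ∈ P, ¬ (q.cover T ⊂ r.cover T ∧ r.cover T ⊂ p.cover T)

/-- The boundary `∂p`: the nodes covered by `p` but by no direct subpattern. -/
def boundary {k : ℕ} (T : PosTree k) (P : Finset (Pattern k)) (p : Pattern k) :
    Set (List (Fin k)) :=
  p.cover T \ ⋃ q ∈ {q | DirectSub T P q p}, q.cover T

/-- The size of the branching tree of `p`: the number of boundary nodes plus the
number of direct subpatterns (each direct subpattern is contracted to a single
node). -/
noncomputable def branchSize {k : ℕ} (T : PosTree k) (P : Finset (Pattern k))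
    (p : Pattern k) : ℕ :=
  (boundary T P p).ncard + {q | DirectSub T P q p}.ncard

/-- The width of `P` is at most `W`: every branching tree has size at most `W`. -/
def WidthLE {k : ℕ} (T : PosTree k) (P : Finset (Pattern k)) (W : ℕ) : Prop :=
  ∀ p ∈ P, branchSize T P p ≤ W

/-- The depth of `P` (the height of its pattern tree) is at most `d`: every
strictly decreasing chain of patterns of `P` has at most `d + 1` elements. -/
def DepthLE {k : ℕ} (T : PosTree k) (P : Finset (Pattern k)) (d : ℕ) : Prop :=
  ∀ c : List (Pattern k), (∀ p ∈ c, p ∈ P) →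
    c.Chain' (fun p q => q.cover T ⊂ p.cover T) → c.length ≤ d + 1

/-- Auxiliary: a decomposition `P` of the pattern `p` of width 5 and depth `d`. -/
structure Dec (T : PosTree 2) (p : Pattern 2) (P : Finset (Pattern 2)) (d : ℕ) : Prop where
  valid : ∀ r ∈ P, r.Valid T
  sub : ∀ r ∈ P, r.cover T ⊆ p.cover T
  ssub : ∀ r ∈ P, r ≠ p → r.cover T ⊂ p.cover T
  mem : (p.cover T).Nonempty → p ∈ P
  nested : ∀ p ∈ P, ∀ q ∈ P,
    Disjoint (p.cover T) (q.cover T) ∨ p.cover T ⊆ q.cover T ∨ q.cover T ⊆ p.cover T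
  width : WidthLE T P 5
  depth : DepthLE T P d

theorem cover_nonempty {T : PosTree 2} {p : Pattern 2} (h : p.Valid T) :
    (p.cover T).Nonempty := by
  cases p with
  | subtree v => exact ⟨v, h, List.prefix_refl v⟩
  | context v w =>
    obtain ⟨h1, h2, h3, h4⟩ := h
    refine ⟨v, h1, List.prefix_refl v, fun h => h4 ?_⟩
    exact h3.eq_of_length_le h.length_le

theorem cover_finite (T : PosTree 2) (p : Pattern 2) : (p.cover T).Finite := by
  refine T.nodes.finite_toSet.subset ?_
  cases p with
  | subtree v => exact fun u hu => hu.1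
  | context v w => exact fun u hu => hu.1

theorem dec_empty {T : PosTree 2} {p : Pattern 2} (h : p.cover T = ∅) (d : ℕ) :
    ∃ P, Dec T p P d := by
  refine ⟨∅, ?_, ?_, ?_, ?_, ?_, ?_, ?_⟩
  · simp
  · simp
  · simp
  · simp [h]
  · simp
  · intro p hp; simp at hp
  · intro c hc _
    cases c with
    | nil => simp
    | cons a t => have := hc a (by simp); simp at this

theorem dec_mono {T : PosTree 2} {p : Pattern 2} {d e : ℕ} (hde : d ≤ e)
    (h : ∃ P, Dec T p P d) : ∃ P, Dec T p P e := by
  obtain ⟨P, h⟩ := h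
  exact ⟨P, h.valid, h.sub, h.ssub, h.mem, h.nested, h.width,
    fun c h1 h2 => (h.depth c h1 h2).trans (by omega)⟩

theorem chain_head {T : PosTree 2} : ∀ (t : List (Pattern 2)) (a : Pattern 2),
    (a :: t).IsChain (fun p q => q.cover T ⊂ p.cover T) →
    ∀ b ∈ t, b.cover T ⊂ a.cover T := by
  intro t
  induction t with
  | nil => intro a _ b hb; simp at hb
  | cons c t ih =>
    intro a h b hb
    rw [List.isChain_cons_cons] at h
    rcases List.mem_cons.1 hb with rfl | hb
    · exact h.1
    · exact (ih c h.2 b hb).trans h.1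

theorem comb {T : PosTree 2} {p : Pattern 2} (hp : p.Valid T) (x : List (Fin 2))
    (q : Fin 3 → Pattern 2) {d : ℕ}
    (hx : x ∈ p.cover T)
    (hsub : ∀ i, (q i).cover T ⊆ p.cover T)
    (hxq : ∀ i, x ∉ (q i).cover T)
    (hdisj : ∀ i j, i ≠ j → ∀ u, u ∈ (q i).cover T → u ∈ (q j).cover T → False)
    (hcov : ∀ u ∈ p.cover T, u ≠ x → ∃ i, u ∈ (q i).cover T)
    (hq : ∀ i, ∃ P, Dec T (q i) P d) : ∃ P, Dec T p P (d + 1) := by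
  choose P hP using hq
  have hqp : ∀ i, (q i).cover T ⊂ p.cover T := fun i =>
    ⟨hsub i, fun h => hxq i (h hx)⟩
  have hrp : ∀ i, ∀ r ∈ P i, r.cover T ⊂ p.cover T := fun i r hr =>
    ((hP i).sub r hr).trans_ssubset (hqp i)
  have huniq : ∀ i j r s, r ∈ P i → s ∈ P j → ∀ u, u ∈ r.cover T → u ∈ s.cover T → i = j := by
    intro i j r s hr hs u hur hus
    by_contra hij
    exact hdisj i j hij u ((hP i).sub r hr hur) ((hP j).sub s hs hus)
  have hmem : ∀ r, r ∈ insert p (Finset.univ.biUnion P) ↔ r = p ∨ ∃ i, r ∈ P i := by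
    intro r; simp
  generalize insert p (Finset.univ.biUnion P) = P' at hmem
  have hlow : ∀ r ∈ P', r.cover T ⊂ p.cover T → ∃ i, r ∈ P i := by
    intro r hr h
    rcases (hmem r).1 hr with rfl | h'
    · exact absurd h (ssubset_irrefl _)
    · exact h'
  have hval : ∀ r ∈ P', r.Valid T := by
    intro r hr
    rcases (hmem r).1 hr with rfl | ⟨i, hi⟩
    · exact hp
    · exact (hP i).valid r hi
  have hbelow : ∀ i r s, r ∈ P i → s ∈ P' → s.cover T ⊂ r.cover T → s ∈ P i := by
    intro i r s hr hs h
    obtain ⟨j, hj⟩ := hlow s hs (h.trans (hrp i r hr))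
    obtain ⟨u, hu⟩ := cover_nonempty (hval s hs)
    rw [huniq i j r s hr hj u (h.1 hu) hu]
    exact hj
  refine ⟨P', hval, ?_, ?_, fun _ => (hmem p).2 (Or.inl rfl), ?_, ?_, ?_⟩
  · intro r hr
    rcases (hmem r).1 hr with rfl | ⟨i, hi⟩
    · exact subset_rfl
    · exact (hrp i r hi).1
  · intro r hr hne
    rcases (hmem r).1 hr with rfl | ⟨i, hi⟩
    · exact absurd rfl hne
    · exact hrp i r hi
  · intro r hr s hs
    rcases (hmem r).1 hr with rfl | ⟨i, hi⟩ <;> rcases (hmem s).1 hs with rfl | ⟨j, hj⟩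
    · exact Or.inr (Or.inl subset_rfl)
    · exact Or.inr (Or.inr (hrp j s hj).1)
    · exact Or.inr (Or.inl (hrp i r hi).1)
    · by_cases hij : i = j
      · subst hij
        exact (hP i).nested r hi s hj
      · left
        rw [Set.disjoint_left]
        intro u h1 h2
        exact hij (huniq i j r s hi hj u h1 h2)
  · intro r hr
    rcases (hmem r).1 hr with rfl | ⟨i, hi⟩
    · have h1 : {s | DirectSub T P' s r} ⊆ Set.range q := by
        rintro s ⟨hs, -, hsr, hs4⟩
        obtain ⟨i, hi⟩ := hlow s hs hsr
        refine ⟨i, ?_⟩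
        by_contra hne
        have hss := (hP i).ssub s hi (Ne.symm hne)
        obtain ⟨u, hu⟩ := cover_nonempty (hval s hs)
        have hqi := (hP i).mem ⟨u, hss.1 hu⟩
        exact hs4 (q i) ((hmem _).2 (Or.inr ⟨i, hqi⟩)) ⟨hss, hqp i⟩
      have h2 : boundary T P' r ⊆ {x} := by
        rintro u ⟨hu, hu2⟩
        by_contra hne
        obtain ⟨i, hi⟩ := hcov u hu hne
        apply hu2
        simp only [Set.mem_iUnion]
        refine ⟨q i, ?_, hi⟩
        have hqi := (hP i).mem ⟨u, hi⟩
        refine ⟨(hmem _).2 (Or.inr ⟨i, hqi⟩), hr, hqp i, ?_⟩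
        rintro s hs ⟨h3, h4⟩
        obtain ⟨j, hj⟩ := hlow s hs h4
        have hij := huniq i j (q i) s hqi hj u hi (h3.1 hi)
        subst hij
        exact h3.2 ((hP i).sub s hj)
      have h3 := Set.ncard_le_ncard h1 (Set.finite_range q)
      have h4 := Set.ncard_le_ncard h2 (Set.finite_singleton x)
      have h5 : (Set.range q).ncard ≤ 3 := by
        rw [← Set.image_univ]
        refine (Set.ncard_image_le Set.finite_univ).trans ?_
        simp [Set.ncard_univ]
      rw [Set.ncard_singleton] at h4
      unfold branchSize
      omega
    · have h1 : ∀ s, DirectSub T P' s r ↔ DirectSub T (P i) s r := by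
        intro s
        constructor
        · rintro ⟨a, b, c, e⟩
          exact ⟨hbelow i r s hi a c, hi, c,
            fun t ht => e t ((hmem t).2 (Or.inr ⟨i, ht⟩))⟩
        · rintro ⟨a, b, c, e⟩
          exact ⟨(hmem s).2 (Or.inr ⟨i, a⟩), hr, c,
            fun t ht h => e t (hbelow i r t hi ht h.2) h⟩
      have := (hP i).width r hi
      unfold branchSize boundary at this ⊢
      simpa only [h1] using this
  · intro c hc hch
    cases c with
    | nil => simp
    | cons a t =>
      cases t with
      | nil => simp
      | cons b t =>
        have hch' : (a :: b :: t).IsChain (fun p q => q.cover T ⊂ p.cover T) := hch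
        rw [List.isChain_cons_cons] at hch'
        have hb : ∃ i, b ∈ P i := by
          rcases (hmem a).1 (hc a (by simp)) with rfl | ⟨i, hi⟩
          · exact hlow b (hc b (by simp)) hch'.1
          · exact ⟨i, hbelow i a b hi (hc b (by simp)) hch'.1⟩
        obtain ⟨i, hi⟩ := hb
        have := (hP i).depth (b :: t) (by
          intro s hs
          rcases List.mem_cons.1 hs with rfl | hs'
          · exact hi
          · exact hbelow i b s hi (hc s (by simp [hs'])) (chain_head t b hch'.2 s hs')) hch'.2
        simp only [List.length_cons] at this ⊢
        omega

theorem prefix_step {x u : List (Fin 2)} (h : x <+: u) (hne : x ≠ u) :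
    ∃ i, x ++ [i] <+: u := by
  obtain ⟨t, rfl⟩ := h
  cases t with
  | nil => simp at hne
  | cons i t => exact ⟨i, t, by simp⟩

theorem child_unique {x u : List (Fin 2)} {i j : Fin 2} (h1 : x ++ [i] <+: u)
    (h2 : x ++ [j] <+: u) : i = j := by
  have := (List.prefix_of_prefix_length_le h1 h2 (by simp)).eq_of_length (by simp)
  simpa using this

theorem not_child_prefix {x : List (Fin 2)} {i : Fin 2} : ¬ (x ++ [i] <+: x) := by
  intro h
  have := h.length_le
  simp at this

theorem prefix_child (x : List (Fin 2)) (i : Fin 2) : x <+: x ++ [i] := ⟨[i], rfl⟩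

theorem step_subtree {T : PosTree 2} {k d : ℕ}
    (hS : ∀ v, ((Pattern.subtree v).cover T).ncard < 2 ^ k → ∃ P, Dec T (.subtree v) P d)
    (hC : ∀ v w, v <+: w → w ∈ T.nodes → ((Pattern.context v w).cover T).ncard < 2 ^ k →
      ∃ P, Dec T (.context v w) P d)
    (v : List (Fin 2)) (hv : ((Pattern.subtree v).cover T).ncard < 2 ^ (k + 1)) :
    ∃ P, Dec T (.subtree v) P (d + 1) := by
  classical
  by_cases hvT : v ∈ T.nodes
  swap
  · apply dec_empty
    ext u
    simp only [Set.mem_empty_iff_false, iff_false]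
    exact fun hu => hvT (T.prefix_closed v u hu.2 hu.1)
  have hpos : 0 < ((Pattern.subtree v).cover T).ncard :=
    (Set.ncard_pos (cover_finite T _)).2 ⟨v, hvT, List.prefix_refl v⟩
  set N := ((Pattern.subtree v).cover T).ncard with hN
  obtain ⟨w, hw, hmax⟩ := Finset.exists_max_image
    (T.nodes.filter (fun w => v <+: w ∧ N < 2 * ((Pattern.subtree w).cover T).ncard))
    List.length ⟨v, by simp only [Finset.mem_filter]; exact ⟨hvT, List.prefix_refl v, by omega⟩⟩
  simp only [Finset.mem_filter] at hw hmax
  obtain ⟨hwT, hvw, hwN⟩ := hw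
  have hchild : ∀ i, ((Pattern.subtree (w ++ [i])).cover T).ncard < 2 ^ k := by
    intro i
    by_contra hcon
    have hp := Nat.one_le_two_pow (n := k)
    rw [pow_succ] at hv
    have hne : ((Pattern.subtree (w ++ [i])).cover T).Nonempty := by
      apply Set.nonempty_of_ncard_ne_zero
      omega
    obtain ⟨u, hu1, hu2⟩ := hne
    have := hmax (w ++ [i]) ⟨T.prefix_closed _ _ hu2 hu1, hvw.trans (prefix_child w i), by omega⟩
    simp at this
  have hctx : ((Pattern.context v w).cover T).ncard < 2 ^ k := by
    have hun : (Pattern.subtree v).cover T =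
        (Pattern.context v w).cover T ∪ (Pattern.subtree w).cover T := by
      ext u
      simp only [Pattern.cover, Set.mem_union, Set.mem_setOf_eq]
      constructor
      · rintro ⟨a, b⟩
        by_cases h : w <+: u
        · exact Or.inr ⟨a, h⟩
        · exact Or.inl ⟨a, b, h⟩
      · rintro (⟨a, b, -⟩ | ⟨a, b⟩)
        · exact ⟨a, b⟩
        · exact ⟨a, hvw.trans b⟩
    have hd : Disjoint ((Pattern.context v w).cover T) ((Pattern.subtree w).cover T) := by
      rw [Set.disjoint_left]
      exact fun u h1 h2 => h1.2.2 h2.2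
    have := Set.ncard_union_eq hd (cover_finite T _) (cover_finite T _)
    rw [← hun, ← hN] at this
    rw [pow_succ] at hv
    omega
  refine comb (p := .subtree v) hvT w
    ![.context v w, .subtree (w ++ [0]), .subtree (w ++ [1])] ⟨hwT, hvw⟩ ?_ ?_ ?_ ?_ ?_
  · intro i u hu
    fin_cases i
    · exact ⟨hu.1, hu.2.1⟩
    · exact ⟨hu.1, (hvw.trans (prefix_child w _)).trans hu.2⟩
    · exact ⟨hu.1, (hvw.trans (prefix_child w _)).trans hu.2⟩
  · intro i hu
    fin_cases i
    · exact hu.2.2 (List.prefix_refl w)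
    · exact not_child_prefix hu.2
    · exact not_child_prefix hu.2
  · have key : ∀ u, (u ∈ (Pattern.context v w).cover T →
        ∀ i, u ∈ (Pattern.subtree (w ++ [i])).cover T → False) :=
      fun u h1 i h2 => h1.2.2 ((prefix_child w i).trans h2.2)
    have key2 : ∀ u, u ∈ (Pattern.subtree (w ++ [0])).cover T →
        u ∈ (Pattern.subtree (w ++ [1])).cover T → False := by
      intro u h1 h2
      have := child_unique h1.2 h2.2
      simp at this
    intro i j hij u h1 h2
    fin_cases i <;> fin_cases j
    · exact hij rfl
    · exact key u h1 _ h2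
    · exact key u h1 _ h2
    · exact key u h2 _ h1
    · exact hij rfl
    · exact key2 u h1 h2
    · exact key u h2 _ h1
    · exact key2 u h2 h1
    · exact hij rfl
  · intro u hu hne
    by_cases h : w <+: u
    · obtain ⟨i, hi⟩ := prefix_step h (Ne.symm hne)
      fin_cases i
      · exact ⟨1, hu.1, hi⟩
      · exact ⟨2, hu.1, hi⟩
    · exact ⟨0, hu.1, hu.2, h⟩
  · intro i
    fin_cases i
    · exact hC v w hvw hwT hctx
    · exact hS _ (hchild 0)
    · exact hS _ (hchild 1)

theorem step_context {T : PosTree 2} {k d : ℕ}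
    (hS : ∀ v, ((Pattern.subtree v).cover T).ncard < 2 ^ (k + 1) → ∃ P, Dec T (.subtree v) P d)
    (hC : ∀ v w, v <+: w → w ∈ T.nodes → ((Pattern.context v w).cover T).ncard < 2 ^ k →
      ∃ P, Dec T (.context v w) P d)
    (v w : List (Fin 2)) (hvw : v <+: w) (hwT : w ∈ T.nodes)
    (hv : ((Pattern.context v w).cover T).ncard < 2 ^ (k + 1)) :
    ∃ P, Dec T (.context v w) P (d + 1) := by
  classical
  by_cases hne : v = w
  · apply dec_empty
    ext u
    simp only [Set.mem_empty_iff_false, iff_false]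
    subst hne
    exact fun hu => hu.2.2 hu.2.1
  have hvT : v ∈ T.nodes := T.prefix_closed v w hvw hwT
  set N := ((Pattern.context v w).cover T).ncard with hN
  have hvv : ((Pattern.context v v).cover T) = ∅ := by
    ext u
    simp only [Set.mem_empty_iff_false, iff_false]
    exact fun hu => hu.2.2 hu.2.1
  obtain ⟨x, hx, hmax⟩ := Finset.exists_max_image
    (T.nodes.filter (fun x => v <+: x ∧ x <+: w ∧ x ≠ w ∧
      2 * ((Pattern.context v x).cover T).ncard ≤ N))
    List.length ⟨v, by
      simp only [Finset.mem_filter]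
      exact ⟨hvT, List.prefix_refl v, hvw, hne, by simp [hvv]⟩⟩
  simp only [Finset.mem_filter] at hx hmax
  obtain ⟨hxT, hvx, hxw, hxne, hxN⟩ := hx
  obtain ⟨i, hi⟩ := prefix_step hxw hxne
  obtain ⟨j, hij, hall⟩ : ∃ j : Fin 2, i ≠ j ∧ ∀ l : Fin 2, l = i ∨ l = j := by
    clear hi; revert i; decide
  have hxiT : x ++ [i] ∈ T.nodes := T.prefix_closed _ _ hi hwT
  have hwx : ¬ w <+: x := fun h => hxne (hxw.eq_of_length_le h.length_le)
  have hsubs : (Pattern.subtree (x ++ [j])).cover T ⊆ (Pattern.context v w).cover T := by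
    intro u hu
    exact ⟨hu.1, (hvx.trans (prefix_child x j)).trans hu.2,
      fun h => hij (child_unique (hi.trans h) hu.2)⟩
  rw [pow_succ] at hv
  have hlow : ((Pattern.context (x ++ [i]) w).cover T).ncard < 2 ^ k := by
    by_cases hxi : x ++ [i] = w
    · have : (Pattern.context (x ++ [i]) w).cover T = ∅ := by
        ext u
        simp only [Set.mem_empty_iff_false, iff_false]
        exact fun hu => hu.2.2 (hxi ▸ hu.2.1)
      rw [this]
      simp
    have hbig : N < 2 * ((Pattern.context v (x ++ [i])).cover T).ncard := by
      by_contra hcon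
      have := hmax (x ++ [i]) ⟨hxiT, hvx.trans (prefix_child x i), hi, hxi, by omega⟩
      simp at this
    have hun : (Pattern.context v w).cover T =
        (Pattern.context v (x ++ [i])).cover T ∪ (Pattern.context (x ++ [i]) w).cover T := by
      ext u
      simp only [Pattern.cover, Set.mem_union, Set.mem_setOf_eq]
      constructor
      · rintro ⟨a, b, c⟩
        by_cases h : x ++ [i] <+: u
        · exact Or.inr ⟨a, h, c⟩
        · exact Or.inl ⟨a, b, h⟩
      · rintro (⟨a, b, c⟩ | ⟨a, b, c⟩)
        · exact ⟨a, b, fun h => c (hi.trans h)⟩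
        · exact ⟨a, (hvx.trans (prefix_child x i)).trans b, c⟩
    have hd : Disjoint ((Pattern.context v (x ++ [i])).cover T)
        ((Pattern.context (x ++ [i]) w).cover T) := by
      rw [Set.disjoint_left]
      exact fun u h1 h2 => h1.2.2 h2.2.1
    have := Set.ncard_union_eq hd (cover_finite T _) (cover_finite T _)
    rw [← hun, ← hN] at this
    omega
  refine comb (p := .context v w) ⟨hvT, hwT, hvw, hne⟩ x
    ![.context v x, .context (x ++ [i]) w, .subtree (x ++ [j])] ⟨hxT, hvx, hwx⟩ ?_ ?_ ?_ ?_ ?_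
  · intro l u hu
    fin_cases l
    · exact ⟨hu.1, hu.2.1, fun h => hu.2.2 (hxw.trans h)⟩
    · exact ⟨hu.1, (hvx.trans (prefix_child x _)).trans hu.2.1, hu.2.2⟩
    · exact hsubs hu
  · intro l hu
    fin_cases l
    · exact hu.2.2 (List.prefix_refl x)
    · exact not_child_prefix hu.2.1
    · exact not_child_prefix hu.2
  · have key1 : ∀ u, u ∈ (Pattern.context v x).cover T →
        u ∈ (Pattern.context (x ++ [i]) w).cover T → False :=
      fun u h1 h2 => h1.2.2 ((prefix_child x i).trans h2.2.1)
    have key2 : ∀ u, u ∈ (Pattern.context v x).cover T →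
        u ∈ (Pattern.subtree (x ++ [j])).cover T → False :=
      fun u h1 h2 => h1.2.2 ((prefix_child x j).trans h2.2)
    have key3 : ∀ u, u ∈ (Pattern.context (x ++ [i]) w).cover T →
        u ∈ (Pattern.subtree (x ++ [j])).cover T → False :=
      fun u h1 h2 => hij (child_unique h1.2.1 h2.2)
    intro a b hab u h1 h2
    fin_cases a <;> fin_cases b
    · exact hab rfl
    · exact key1 u h1 h2
    · exact key2 u h1 h2
    · exact key1 u h2 h1
    · exact hab rfl
    · exact key3 u h1 h2
    · exact key2 u h2 h1
    · exact key3 u h2 h1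
    · exact hab rfl
  · intro u hu hux
    by_cases h : x <+: u
    · obtain ⟨l, hl⟩ := prefix_step h (Ne.symm hux)
      rcases hall l with rfl | rfl
      · exact ⟨1, hu.1, hl, hu.2.2⟩
      · exact ⟨2, hu.1, hl⟩
    · exact ⟨0, hu.1, hu.2.1, h⟩
  · intro l
    fin_cases l
    · exact hC v x hvx hxT (by omega)
    · exact hC _ w hi hwT hlow
    · refine hS _ (lt_of_le_of_lt (Set.ncard_le_ncard hsubs (cover_finite T _)) ?_)
      rw [pow_succ]
      exact hv

theorem dec_all (T : PosTree 2) (k : ℕ) :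
    (∀ v, ((Pattern.subtree v).cover T).ncard < 2 ^ k →
      ∃ P, Dec T (.subtree v) P (2 * k)) ∧
    (∀ v w, v <+: w → w ∈ T.nodes → ((Pattern.context v w).cover T).ncard < 2 ^ k →
      ∃ P, Dec T (.context v w) P (2 * k + 1)) := by
  induction k with
  | zero =>
    constructor
    · intro v h
      apply dec_empty
      rw [← Set.ncard_eq_zero (cover_finite T _)]
      simpa using h
    · intro v w _ _ h
      apply dec_empty
      rw [← Set.ncard_eq_zero (cover_finite T _)]
      simpa using h
  | succ k ih =>
    have h1 : ∀ v, ((Pattern.subtree v).cover T).ncard < 2 ^ (k + 1) →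
        ∃ P, Dec T (.subtree v) P (2 * (k + 1)) :=
      step_subtree (d := 2 * k + 1) (fun v h => dec_mono (by omega) (ih.1 v h)) ih.2
    exact ⟨h1, step_context h1 (fun v w a b h => dec_mono (by omega) (ih.2 v w a b h))⟩

/-- Combinatorial form of Proposition 4.2. -/
theorem stmt6 :
    ∃ C : ℝ, 0 < C ∧
      ∀ (T : PosTree 2), T.IsFullBinary →
        ∀ n : ℕ, n = T.nodes.card → 2 ≤ n →
          ∃ P : Finset (Pattern 2), IsHierDef T P ∧ WidthLE T P 5 ∧
            ∃ d : ℕ, (d : ℝ) ≤ C * Real.logb 2 n ∧ DepthLE T P d := by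
  refine ⟨4, by norm_num, ?_⟩
  intro T _ n hn h2
  have hcov : (Pattern.subtree ([] : List (Fin 2))).cover T = (T.nodes : Set (List (Fin 2))) := by
    ext u
    simp [Pattern.cover]
  obtain ⟨P, hP⟩ := (dec_all T (Nat.log 2 n + 1)).1 [] (by
    rw [hcov, Set.ncard_coe_finset, ← hn]
    exact Nat.lt_pow_succ_log_self (by norm_num) n)
  refine ⟨P, ⟨hP.valid, hP.mem ⟨[], by rw [hcov]; exact T.root_mem⟩, hP.nested⟩, hP.width,
    _, ?_, hP.depth⟩
  have h3 : (Nat.log 2 n : ℝ) ≤ Real.logb 2 n := by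
    have := Real.natLog_le_logb n 2
    exact_mod_cast this
  have h4 : 1 ≤ Nat.log 2 n := Nat.log_pos (by norm_num) h2
  have h5 : (1 : ℝ) ≤ Nat.log 2 n := by exact_mod_cast h4
  push_cast
  linarith
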